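/- Let L be a d-generator generalized Heisenberg Lie algebra over a field k with d ≥ 3 such that dim L² = ½d(d−1) − 1 or dim L² = ½d(d−1) − 2. Then L is capable, i.e., there exists a Lie algebra E over k with E/Z(E) ≅ L. -/

import Mathlib

open Module

universe u v

variable (k : Type u) [Field k]

/-- The derived subalgebra `L² = [L,L]` of a Lie algebra, as a `k`-submodule. -/
abbrev lieSq (L : Type v) [LieRing L] [LieAlgebra k L] : Submodule k L :=
  (LieModule.lowerCentralSeries k L L 1).toSubmodule

/-- A witness to the capability of the Lie algebra `L`: a Lie algebra `E`
together with an isomorphism `E/Z(E) ≅ L`. -/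
structure CapableWitness (L : Type v) [LieRing L] [LieAlgebra k L] : Type (max u (v + 1)) where
  E : Type v
  [instLieRing : LieRing E]
  [instLieAlgebra : LieAlgebra k E]
  equiv : (E ⧸ LieAlgebra.center k E) ≃ₗ⁅k⁆ L

variable {k}

section CentralExtension

variable {L M : Type v} [LieRing L] [LieAlgebra k L] [AddCommGroup M] [Module k M]

/-- An alternating 2-cocycle with trivial coefficients which pairs every nonzero central element
nontrivially with `L` exhibits `L` as the central quotient of the associated central extension. -/
theorem capableWitness_of_cocycle (f : L →ₗ[k] L →ₗ[k] M) (halt : ∀ x, f x x = 0)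
    (hcocycle : ∀ x y z, f x ⁅y, z⁆ + f y ⁅z, x⁆ + f z ⁅x, y⁆ = 0)
    (hcenter : ∀ z ∈ LieAlgebra.center k L, (∀ x, f x z = 0) → z = 0) :
    Nonempty (CapableWitness k L) := by
  let : LieRingModule L M :=
    { bracket _ _ := 0
      add_lie _ _ _ := by simp
      lie_add _ _ _ := by simp
      leibniz_lie _ _ _ := by simp }
  have htriv (x : L) (m : M) : ⁅x, m⁆ = 0 := rfl
  have : LieModule k L M :=
    { smul_lie _ _ _ := by simp [htriv]
      lie_smul _ _ _ := by simp [htriv] }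
  have hskew (x y : L) : f x y = - f y x := by
    have h := halt (x + y)
    simp only [map_add, LinearMap.add_apply, halt, zero_add, add_zero] at h
    exact eq_neg_of_add_eq_zero_right h
  let c : LieModule.Cohomology.twoCocycle k L M := ⟨⟨f, halt⟩, by
    rw [LieModule.Cohomology.mem_twoCocycle_iff]
    ext x y z
    have h := hcocycle x y z
    rw [← lie_skew z x, map_neg] at h
    rw [LieModule.Cohomology.d₂₃_apply]
    change 0 - 0 + 0 - f ⁅x, y⁆ z + f ⁅x, z⁆ y - f ⁅y, z⁆ x = 0
    rw [hskew _ z, hskew _ y, hskew _ x]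
    refine Eq.trans ?_ h
    abel⟩
  let E := LieAlgebra.ofTwoCocycle c
  let π : E →ₗ⁅k⁆ L :=
    { toFun x := x.carrier.1
      map_add' _ _ := rfl
      map_smul' _ _ := rfl
      map_lie' := rfl }
  have hbr (x y : E) : ⁅x, y⁆ = ⟨(⁅x.carrier.1, y.carrier.1⁆, f x.carrier.1 y.carrier.1)⟩ := by
    rw [LieAlgebra.bracket_ofTwoCocycle]
    change (⟨(_, f x.carrier.1 y.carrier.1 + 0 - 0)⟩ : E) = _
    rw [add_zero, sub_zero]
    rfl
  have hker : LieAlgebra.center k E = π.ker := by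
    ext z
    rw [LieModule.mem_maxTrivSubmodule, LieHom.mem_ker]
    refine ⟨fun h => hcenter _ ?_ fun x => ?_, fun h x => ?_⟩
    · rw [LieModule.mem_maxTrivSubmodule]
      exact fun x => congrArg (fun w : E => w.carrier.1) (h ⟨(x, 0)⟩)
    · have h' := h ⟨(x, 0)⟩
      rw [hbr] at h'
      exact congrArg (fun w : E => w.carrier.2) h'
    · change z.carrier.1 = 0 at h
      rw [hbr, h, lie_zero, map_zero]
      rfl
  have hsurj : π.range = ⊤ := by
    rw [LieHom.range_eq_top]
    exact fun x => ⟨⟨(x, 0)⟩, rfl⟩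
  refine ⟨⟨E, ?_⟩⟩
  rw [hker]
  exact π.quotKerEquivRange.trans
    ((LieEquiv.ofEq _ _ (by rw [hsurj])).trans LieSubalgebra.topEquiv)

end CentralExtension

section Trivectors

variable {ι : Type*}

/-- A family of scalars indexed by triples which is totally alternating. -/
structure IsTrivector (T : ι → ι → ι → k) : Prop where
  swap_left : ∀ i j l, T j i l = - T i j l
  swap_right : ∀ i j l, T i l j = - T i j l
  self_left : ∀ i l, T i i l = 0

namespace IsTrivector

variable {T : ι → ι → ι → k}

theorem self_right (hT : IsTrivector T) (i j : ι) : T i j j = 0 := by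
  rw [hT.swap_left, hT.swap_right, hT.self_left, neg_zero, neg_zero]

theorem self_outer (hT : IsTrivector T) (i j : ι) : T i j i = 0 := by
  rw [hT.swap_right, hT.self_left, neg_zero]

theorem rotate (hT : IsTrivector T) (i j l : ι) : T j l i = T i j l := by
  rw [hT.swap_right, hT.swap_left, neg_neg]

theorem add {S : ι → ι → ι → k} (hS : IsTrivector S) (hT : IsTrivector T) :
    IsTrivector (S + T) where
  swap_left i j l := by simp [hS.swap_left i j, hT.swap_left i j, add_comm]
  swap_right i j l := by simp [hS.swap_right i j, hT.swap_right i j, add_comm]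
  self_left i l := by simp [hS.self_left, hT.self_left]

theorem smul (r : k) (hT : IsTrivector T) : IsTrivector (r • T) where
  swap_left i j l := by simp [hT.swap_left i j]
  swap_right i j l := by simp [hT.swap_right i j]
  self_left i l := by simp [hT.self_left]

theorem zero : IsTrivector (0 : ι → ι → ι → k) where
  swap_left := by simp
  swap_right := by simp
  self_left := by simp

/-- The decomposable trivector `x ∧ y ∧ w`, expanded along the first index. -/
theorem wedge (x y w : ι → k) : IsTrivector fun m i j =>
    x m * (y i * w j - w i * y j) + y m * (w i * x j - x i * w j)
      + w m * (x i * y j - y i * x j) where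
  swap_left := by intros; ring
  swap_right := by intros; ring
  self_left := by intros; ring

/-- If the slices of a trivector `S` lie in the span of three slices `T p`, `T a`, `T b` of a
trivector `T` with `T p a b ≠ 0`, then `T p` cannot occur exactly in the `q`-th slice of `S`
for `q ≠ p`. -/
theorem false_of_slices [DecidableEq ι] {S : ι → ι → ι → k} (hT : IsTrivector T)
    (hS : IsTrivector S) {p q a b : ι} (hpq : p ≠ q) (hne : T p a b ≠ 0) (α β : ι → k)
    (h : ∀ i j l, S i j l = (Pi.single q 1 : ι → k) i * T p j l + α i * T a j l + β i * T b j l) :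
    False := by
  have hβ (i) : S i p a = β i * T p a b := by
    rw [h, hT.self_left, hT.self_outer, ← hT.rotate b p a]; ring
  have hα (i) : S i b p = α i * T p a b := by
    rw [h, hT.self_left b, hT.self_outer, hT.rotate p a b]; ring
  have hδ (i) : S i a b = (Pi.single q 1 : ι → k) i * T p a b := by
    rw [h, hT.self_left, hT.self_outer b a]; ring
  have hp : S p a b = 0 := by rw [hδ, Pi.single_eq_of_ne hpq, zero_mul]
  have hαa : α a = 0 := by
    have := hα a
    rw [hS.rotate p a b, hp] at this
    simpa [hne] using this.symm
  have hβa : β a = 0 := by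
    have := hβ a
    rw [hS.self_outer] at this
    simpa [hne] using this.symm
  have hδa : (Pi.single q 1 : ι → k) a = 0 := by
    have := hδ a
    rw [hS.self_left] at this
    exact (mul_eq_zero.mp this.symm).resolve_right hne
  have hq : S a b q = 0 := by rw [h, hαa, hβa, hδa]; ring
  rw [hS.rotate q a b, hδ, Pi.single_eq_same, one_mul] at hq
  exact hne hq

end IsTrivector

/-- Ordered pairs of distinct indices, indexing a basis of the exterior square. -/
abbrev IncreasingPair (d : ℕ) : Type := {p : Fin d × Fin d // p.1 < p.2}

theorem card_increasingPair (d : ℕ) : Fintype.card (IncreasingPair d) = d * (d - 1) / 2 := by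
  rw [← Finset.sum_range_id, ← Fin.sum_univ_eq_sum_range (fun i => i),
    Fintype.card_congr (Equiv.subtypeProdEquivSigmaSubtype (fun i j : Fin d => i < j)),
    Fintype.card_sigma, ← Equiv.sum_comp Fin.revPerm]
  refine Finset.sum_congr rfl fun i _ => ?_
  rw [Fintype.card_subtype, Finset.filter_lt_eq_Ioi, Fin.card_Ioi]
  simp
  omega

theorem eq_of_eq_on_increasingPair {d : ℕ} {F G : Fin d → Fin d → k} (hF : ∀ i, F i i = 0)
    (hF' : ∀ i j, F j i = - F i j) (hG : ∀ i, G i i = 0) (hG' : ∀ i j, G j i = - G i j)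
    (h : ∀ p : IncreasingPair d, F p.1.1 p.1.2 = G p.1.1 p.1.2) (i j : Fin d) :
    F i j = G i j := by
  rcases lt_trichotomy i j with hij | rfl | hij
  · exact h ⟨(i, j), hij⟩
  · rw [hF, hG]
  · rw [hF', hG', h ⟨(j, i), hij⟩]

/-- Splitting an off-diagonal double sum into pairs. -/
theorem sum_sum_eq_sum_increasingPair {d : ℕ} {M : Type*} [AddCommGroup M]
    (F : Fin d → Fin d → M) (hF : ∀ i, F i i = 0) :
    ∑ i, ∑ j, F i j = ∑ p : IncreasingPair d, (F p.1.1 p.1.2 + F p.1.2 p.1.1) := by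
  have hsub (G : Fin d → Fin d → M) :
      ∑ p : IncreasingPair d, G p.1.1 p.1.2 = ∑ i, ∑ j, if i < j then G i j else 0 := by
    rw [← Fintype.sum_prod_type' (fun i j => if i < j then G i j else 0),
      ← Finset.sum_filter (fun p : Fin d × Fin d => p.1 < p.2) (fun p => G p.1 p.2)]
    exact (Finset.sum_subtype _ (by simp) fun p : Fin d × Fin d => G p.1 p.2).symm
  rw [Finset.sum_add_distrib, hsub F, hsub fun i j => F j i, Finset.sum_comm (f := fun i j =>
    if i < j then F j i else 0), ← Finset.sum_add_distrib]
  refine Finset.sum_congr rfl fun i _ => ?_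
  rw [← Finset.sum_add_distrib]
  refine Finset.sum_congr rfl fun j _ => ?_
  rcases lt_trichotomy i j with hij | rfl | hij
  · simp [hij, hij.not_gt]
  · simp [hF]
  · simp [hij, hij.not_gt]

/-- If the exterior square is cut down by at most two relations, then a vector `z` of the quotient
is zero as soon as each `e i ⊗ z` is the image of a trivector. -/
theorem eq_zero_of_forall_exists_isTrivector {d : ℕ} (hd : 2 ≤ d) {Z : Type*} [AddCommGroup Z]
    [Module k Z] (Φ : (IncreasingPair d → k) →ₗ[k] Z) (hΦ : finrank k Φ.ker ≤ 2) (z : Z)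
    (h : ∀ i, ∃ T : Fin d → Fin d → Fin d → k, IsTrivector T ∧
      ∀ m, Φ (fun p => T m p.1.1 p.1.2) = (Pi.single i z : Fin d → Z) m) : z = 0 := by
  by_contra hz
  let p : Fin d := ⟨0, by omega⟩
  let q : Fin d := ⟨1, by omega⟩
  have hpq : p ≠ q := by simp [p, q]
  obtain ⟨T, hT, hTΦ⟩ := h p
  obtain ⟨S, hS, hSΦ⟩ := h q
  obtain ⟨a, b, hab⟩ : ∃ a b, T p a b ≠ 0 := by
    by_contra! h0
    have h1 := hTΦ p
    simp only [h0, Pi.single_eq_same] at h1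
    exact hz (h1.symm.trans (map_zero Φ))
  have hap : a ≠ p := by
    rintro rfl
    exact hab (hT.self_left _ _)
  have hbp : b ≠ p := by
    rintro rfl
    exact hab (hT.self_outer _ _)
  let u : Φ.ker := ⟨fun s => T a s.1.1 s.1.2, by
    rw [LinearMap.mem_ker, hTΦ, Pi.single_eq_of_ne hap]⟩
  let w : Φ.ker := ⟨fun s => T b s.1.1 s.1.2, by
    rw [LinearMap.mem_ker, hTΦ, Pi.single_eq_of_ne hbp]⟩
  have hind : LinearIndependent k ![u, w] := by
    rw [LinearIndependent.pair_iff]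
    intro s t hst
    have hst' : ∀ i j, s * T a i j + t * T b i j = (0 : Fin d → Fin d → k) i j := by
      refine eq_of_eq_on_increasingPair (F := fun i j => s * T a i j + t * T b i j) ?_ ?_ ?_ ?_ ?_
      · intro i; simp [hT.self_right]
      · intro i j
        simp only [hT.swap_right _ i j]; ring
      · simp
      · simp
      · intro r
        exact congrFun (congrArg Subtype.val hst) r
    have h1 := hst' b p
    have h2 := hst' p a
    rw [hT.self_left, hT.rotate p a b] at h1
    rw [hT.self_outer, ← hT.rotate b p a] at h2
    simp only [Pi.zero_apply, mul_zero, add_zero, zero_add, mul_eq_zero, hab, or_false] at h1 h2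
    exact ⟨h1, h2⟩
  have hspan := hind.span_eq_top_of_card_eq_finrank'
    (le_antisymm hind.fintype_card_le_finrank (by simpa using hΦ))
  have hcomb (i : Fin d) : ∃ α β : k, ∀ j l,
      S i j l = (Pi.single q 1 : Fin d → k) i * T p j l + α * T a j l + β * T b j l := by
    let r : Φ.ker := ⟨(fun s => S i s.1.1 s.1.2) -
        (Pi.single q 1 : Fin d → k) i • (fun s => T p s.1.1 s.1.2), by
      rw [LinearMap.mem_ker, map_sub, map_smul, hSΦ, hTΦ, Pi.single_eq_same]
      by_cases hi : i = q
      · subst hi; simp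
      · simp [hi]⟩
    have hr : r ∈ Submodule.span k (Set.range ![u, w]) := hspan ▸ Submodule.mem_top
    rw [Matrix.range_cons, Matrix.range_cons, Matrix.range_empty, Set.union_empty,
      Set.singleton_union, Submodule.mem_span_pair] at hr
    obtain ⟨α, β, hr⟩ := hr
    refine ⟨α, β, eq_of_eq_on_increasingPair (hS.self_right i) (hS.swap_right i) ?_ ?_ ?_⟩
    · intro j; simp [hT.self_right]
    · intro j l
      simp only [hT.swap_right _ j l]; ring
    · intro s
      have hs : α * T a s.1.1 s.1.2 + β * T b s.1.1 s.1.2 = S i s.1.1 s.1.2 -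
          (Pi.single q 1 : Fin d → k) i * T p s.1.1 s.1.2 :=
        congrFun (congrArg Subtype.val hr) s
      rw [add_assoc, hs]; ring
  choose α β hαβ using hcomb
  exact hT.false_of_slices hS hpq hab α β hαβ

end Trivectors

section Bracket

variable {L : Type v} [LieRing L] [LieAlgebra k L]

theorem lie_mem_lieSq (x y : L) : ⁅x, y⁆ ∈ lieSq k L :=
  LieSubmodule.lie_mem_lie (LieSubmodule.mem_top x) (LieSubmodule.mem_top y)

/-- In a Lie algebra with central derived subalgebra, brackets are determined by coordinates modulo
the derived subalgebra. -/
theorem lie_eq_sum_increasingPair (hH : lieSq k L ≤ (LieAlgebra.center k L).toSubmodule) {d : ℕ}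
    (a : L →ₗ[k] Fin d → k) (e : Fin d → L) (ha : ∀ x, x - ∑ i, a x i • e i ∈ lieSq k L) (x y : L) :
    ⁅x, y⁆ = ∑ p : IncreasingPair d,
      (a x p.1.1 * a y p.1.2 - a y p.1.1 * a x p.1.2) • ⁅e p.1.1, e p.1.2⁆ := by
  have hr (x y : L) : ⁅x, y⁆ = ⁅x, ∑ j, a y j • e j⁆ := by
    have h := (LieModule.mem_maxTrivSubmodule k L L _).mp (hH (ha y)) x
    rwa [lie_sub, sub_eq_zero] at h
  have hl (x y : L) : ⁅x, y⁆ = ⁅∑ i, a x i • e i, y⁆ := by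
    rw [← lie_skew, hr, lie_skew]
  rw [hl, hr, sum_lie]
  simp only [lie_sum, smul_lie, lie_smul]
  rw [sum_sum_eq_sum_increasingPair _ (by simp)]
  refine Finset.sum_congr rfl fun p _ => ?_
  rw [← lie_skew (e p.1.1) (e p.1.2)]
  module

end Bracket

variable (k)

/-- A `d`-generator generalized Heisenberg Lie algebra with `d ≥ 3` and
`dim L² = ½d(d−1) − 1` or `dim L² = ½d(d−1) − 2` is capable. -/
theorem stmt11 (L : Type v) [LieRing L] [LieAlgebra k L] [FiniteDimensional k L]
    (d : ℕ) (hd3 : 3 ≤ d)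
    (hH : LieModule.lowerCentralSeries k L L 1 = LieAlgebra.center k L)
    (hgen : finrank k (L ⧸ lieSq k L) = d)
    (hrk : finrank k (lieSq k L) = d * (d - 1) / 2 - 1 ∨
      finrank k (lieSq k L) = d * (d - 1) / 2 - 2) :
    Nonempty (CapableWitness k L) := by
  let Z := lieSq k L
  have hZ : Z = (LieAlgebra.center k L).toSubmodule := congrArg LieSubmodule.toSubmodule hH
  let b : Basis (Fin d) k (L ⧸ Z) := finBasisOfFinrankEq k _ hgen
  let a : L →ₗ[k] Fin d → k := b.equivFun.toLinearMap ∘ₗ Z.mkQ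
  have ha_zero (x : L) (hx : x ∈ Z) : a x = 0 := by
    change b.equivFun (Z.mkQ x) = 0
    rw [(LinearMap.mem_ker (f := Z.mkQ)).mp (by rwa [Submodule.ker_mkQ]), map_zero]
  choose e he using fun i => Z.mkQ_surjective (b i)
  have hae (i : Fin d) : a (e i) = Pi.single i 1 := by
    change b.equivFun (Z.mkQ (e i)) = _
    rw [he]
    ext j
    simp [Pi.single_apply, eq_comm]
  have ha (x : L) : x - ∑ i, a x i • e i ∈ Z := by
    rw [← Submodule.ker_mkQ Z, LinearMap.mem_ker, map_sub, map_sum, sub_eq_zero]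
    simp only [map_smul, he]
    exact (b.sum_equivFun _).symm
  let br (x y : L) : Z := ⟨⁅x, y⁆, lie_mem_lieSq x y⟩
  have hbr (x y : L) : br x y = ∑ p : IncreasingPair d,
      (a x p.1.1 * a y p.1.2 - a y p.1.1 * a x p.1.2) • br (e p.1.1) (e p.1.2) := by
    ext
    simpa [br] using lie_eq_sum_increasingPair hZ.le a e ha x y
  obtain ⟨P, hP⟩ := Z.subtype.exists_leftInverse_of_injective (by simp)
  replace hP (z : Z) : P z = z := LinearMap.congr_fun hP z
  let Φ : (IncreasingPair d → k) →ₗ[k] Z :=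
    Fintype.linearCombination k fun p => br (e p.1.1) (e p.1.2)
  have hΦbr (x y : L) : Φ (fun p => a x p.1.1 * a y p.1.2 - a y p.1.1 * a x p.1.2) = br x y := by
    rw [hbr, Fintype.linearCombination_apply]
  have hΦ_range : Φ.range = ⊤ := by
    refine Submodule.map_injective_of_injective Z.injective_subtype ?_
    rw [Submodule.map_top, Submodule.range_subtype]
    refine le_antisymm (Submodule.map_subtype_le _ _) ?_
    change (⁅(⊤ : LieIdeal k L), (⊤ : LieSubmodule k L L)⁆).toSubmodule ≤ _
    rw [LieSubmodule.lieIdeal_oper_eq_linear_span', Submodule.span_le]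
    rintro _ ⟨x, -, y, -, rfl⟩
    exact ⟨br x y, ⟨_, hΦbr x y⟩, rfl⟩
  have hΦ_ker : finrank k Φ.ker ≤ 2 := by
    have h := Φ.finrank_range_add_finrank_ker
    rw [hΦ_range, finrank_top, finrank_fintype_fun_eq_card, card_increasingPair] at h
    change finrank k (lieSq k L) + _ = _ at h
    omega
  let J : Submodule k (Fin d → Z) := Submodule.span k (Set.range fun t : L × L × L => fun i =>
    a t.1 i • br t.2.1 t.2.2 + a t.2.1 i • br t.2.2 t.1 + a t.2.2 i • br t.1 t.2.1)
  have hJ (v : Fin d → Z) (hv : v ∈ J) : ∃ T : Fin d → Fin d → Fin d → k, IsTrivector T ∧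
      ∀ m, Φ (fun p => T m p.1.1 p.1.2) = v m := by
    induction hv using Submodule.span_induction with
    | mem v hv =>
      obtain ⟨⟨x, y, w⟩, rfl⟩ := hv
      refine ⟨_, IsTrivector.wedge (a x) (a y) (a w), fun m => ?_⟩
      change _ = a x m • br y w + a y m • br w x + a w m • br x y
      rw [← hΦbr y w, ← hΦbr w x, ← hΦbr x y, ← map_smul, ← map_smul, ← map_smul, ← map_add,
        ← map_add]
      rfl
    | zero => exact ⟨0, IsTrivector.zero, fun m => map_zero Φ⟩
    | add v v' _ _ h h' =>
      obtain ⟨T, hT, hTv⟩ := h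
      obtain ⟨T', hT', hTv'⟩ := h'
      refine ⟨T + T', hT.add hT', fun m => ?_⟩
      change _ = v m + v' m
      rw [← hTv, ← hTv', ← map_add]
      rfl
    | smul r v _ h =>
      obtain ⟨T, hT, hTv⟩ := h
      refine ⟨r • T, hT.smul r, fun m => ?_⟩
      change _ = r • v m
      rw [← hTv, ← map_smul]
      rfl
  let g : L →ₗ[k] L →ₗ[k] Fin d → Z := LinearMap.mk₂ k (fun x y i => a x i • P y - a y i • P x)
    (by intros; ext1; simp only [map_add, Pi.add_apply]; module)
    (by intros; ext1; simp only [map_smul, Pi.smul_apply, smul_eq_mul]; module)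
    (by intros; ext1; simp only [map_add, Pi.add_apply]; module)
    (by intros; ext1; simp only [map_smul, Pi.smul_apply, smul_eq_mul]; module)
  have hg (x : L) (z : Z) : g x z = fun i => a x i • z := by
    ext1 i
    change a x i • P z - a z i • P x = _
    rw [ha_zero z z.2, hP, Pi.zero_apply, zero_smul, sub_zero]
  refine capableWitness_of_cocycle (g.compr₂ J.mkQ) (fun x => ?_) (fun x y w => ?_) ?_
  · rw [LinearMap.compr₂_apply]
    convert map_zero J.mkQ
    ext1
    exact sub_self _
  · simp only [LinearMap.compr₂_apply, ← map_add]
    change J.mkQ (g x (br y w) + g y (br w x) + g w (br x y)) = 0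
    rw [← LinearMap.mem_ker, Submodule.ker_mkQ, hg, hg, hg]
    exact Submodule.subset_span ⟨(x, y, w), rfl⟩
  · intro z hz h
    have hzZ : z ∈ Z := hZ ▸ hz
    have key := eq_zero_of_forall_exists_isTrivector (by omega) Φ hΦ_ker ⟨z, hzZ⟩ fun i =>
      hJ _ (by
        have h' := h (e i)
        rw [LinearMap.compr₂_apply, ← LinearMap.mem_ker, Submodule.ker_mkQ, hg _ ⟨z, hzZ⟩] at h'
        convert h' using 1
        ext1 j
        rw [hae]
        by_cases hj : j = i
        · subst hj; simp
        · simp [hj])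
    exact congrArg Subtype.val key
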